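/- Let n ≥ 1, let a₁, a₂, a₃ ∈ ℤ/2, and set x̃ := x + a₁·x·v + a₂·x^{2n+1}·w + a₃·x^{2n+1}·v·w in R. Then x̃^{2n+2} = 0 and v² = (n+1)·x̃^{2n}·w in R. -/

import Mathlib

open MvPolynomial

noncomputable section

/-- The polynomial ring `(ℤ/2)[x,v,w]`. -/
abbrev P : Type := MvPolynomial (Fin 3) (ZMod 2)

/-- The ideal `(x^{2n+2}, v² + (n+1)·x^{2n}·w)` (the coefficient `n+1` read mod 2). -/
def relIdeal (n : ℕ) : Ideal P :=
  Ideal.span {(X 0 : P) ^ (2 * n + 2),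
    (X 1 : P) ^ 2 + C ((n : ZMod 2) + 1) * (X 0 : P) ^ (2 * n) * X 2}

/-- `R = (ℤ/2)[x,v,w]/(x^{2n+2}, v² + (n+1)x^{2n}w) ≅ ℍ_*(L ℝP^{2n+1}; ℤ/2)`. -/
abbrev R (n : ℕ) : Type := P ⧸ relIdeal n

/-- The quotient map as a `ℤ/2`-algebra homomorphism. -/
def mkR (n : ℕ) : P →ₐ[ZMod 2] R n := Ideal.Quotient.mkₐ (ZMod 2) (relIdeal n)

def x (n : ℕ) : R n := mkR n (X 0)
def v (n : ℕ) : R n := mkR n (X 1)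
def w (n : ℕ) : R n := mkR n (X 2)

theorem two_eq_zero (n : ℕ) : (2 : R n) = 0 := by
  have h := map_ofNat (algebraMap (ZMod 2) (R n)) 2
  rw [← h, show (OfNat.ofNat 2 : ZMod 2) = 0 from rfl, map_zero]

theorem x_pow (n : ℕ) : x n ^ (2 * n + 2) = 0 := by
  rw [x, ← map_pow]
  exact Ideal.Quotient.eq_zero_iff_mem.mpr (Ideal.subset_span (by simp))

theorem v_sq (n : ℕ) : v n ^ 2 = ((n : ZMod 2) + 1) • (x n ^ (2 * n) * w n) := by
  have h : mkR n ((X 1 : P) ^ 2 + C ((n : ZMod 2) + 1) * (X 0 : P) ^ (2 * n) * X 2) = 0 :=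
    Ideal.Quotient.eq_zero_iff_mem.mpr (Ideal.subset_span (by simp))
  rw [mul_assoc, ← smul_eq_C_mul, map_add, map_smul, map_mul, map_pow, map_pow] at h
  change v n ^ 2 + ((n : ZMod 2) + 1) • (x n ^ (2 * n) * w n) = 0 at h
  linear_combination h - ((n : ZMod 2) + 1) • (x n ^ (2 * n) * w n) * two_eq_zero n

theorem perturbed_relations {A : Type*} [CommRing A] [Algebra (ZMod 2) A] {n : ℕ} (hn : 1 ≤ n)
    (h2 : (2 : A) = 0) {x v w : A} {c : ZMod 2} (hx : x ^ (2 * n + 2) = 0)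
    (hv : v ^ 2 = c • (x ^ (2 * n) * w)) (a₁ a₂ a₃ : ZMod 2) :
    (x + a₁ • (x * v) + a₂ • (x ^ (2 * n + 1) * w) + a₃ • (x ^ (2 * n + 1) * v * w))
        ^ (2 * n + 2) = 0 ∧
      v ^ 2 = c • ((x + a₁ • (x * v) + a₂ • (x ^ (2 * n + 1) * w)
        + a₃ • (x ^ (2 * n + 1) * v * w)) ^ (2 * n) * w) := by
  simp only [Algebra.smul_def] at hv ⊢
  generalize algebraMap (ZMod 2) A a₁ = b₁
  generalize algebraMap (ZMod 2) A a₂ = b₂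
  generalize algebraMap (ZMod 2) A a₃ = b₃
  generalize algebraMap (ZMod 2) A c = d at hv ⊢
  have hfac : x + b₁ * (x * v) + b₂ * (x ^ (2 * n + 1) * w) + b₃ * (x ^ (2 * n + 1) * v * w)
      = x * (1 + b₁ * v + x ^ (2 * n) * (b₂ * w + b₃ * v * w)) := by ring
  have hxx : x ^ (2 * n) * x ^ (2 * n) = 0 := by
    rw [← pow_add]
    exact pow_eq_zero_of_le (by omega) hx
  rw [hfac]
  generalize b₂ * w + b₃ * v * w = k
  refine ⟨by rw [mul_pow, hx, zero_mul], ?_⟩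
  rw [mul_pow]
  have hsq : x ^ (2 * n) * (1 + b₁ * v + x ^ (2 * n) * k) ^ 2 = x ^ (2 * n) := by
    generalize x ^ (2 * n) = y at hv hxx ⊢
    linear_combination (y * b₁ * v + y ^ 2 * k + y ^ 2 * b₁ * v * k) * h2
      + y * b₁ ^ 2 * hv + (b₁ ^ 2 * d * w + y * k ^ 2) * hxx
  have hpow (m : ℕ) : x ^ (2 * n) * (1 + b₁ * v + x ^ (2 * n) * k) ^ (2 * m) = x ^ (2 * n) := by
    induction m with
    | zero => simp
    | succ m ih => rw [Nat.mul_succ, pow_add, ← mul_assoc, ih, hsq]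
  rw [hpow, hv]

/-- For `x̃ = x + a₁ x v + a₂ x^{2n+1} w + a₃ x^{2n+1} v w` one has
`x̃^{2n+2} = 0` and `v² = (n+1)·x̃^{2n}·w` in `R`. -/
theorem stmt_6 (n : ℕ) (hn : 1 ≤ n) (a₁ a₂ a₃ : ZMod 2) (xt : R n)
    (hxt : xt = x n + a₁ • (x n * v n) + a₂ • (x n ^ (2 * n + 1) * w n)
      + a₃ • (x n ^ (2 * n + 1) * v n * w n)) :
    xt ^ (2 * n + 2) = 0 ∧ v n ^ 2 = ((n : ZMod 2) + 1) • (xt ^ (2 * n) * w n) := by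
  subst hxt
  exact perturbed_relations hn (two_eq_zero n) (x_pow n) (v_sq n) a₁ a₂ a₃

end
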